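/- arXiv:2111.01507 — 8 statements merged into one kernel-verified Lean document; each statement's English description precedes it below -/
import Mathlib

section
/- Let p ≥ 1 and let Σ ∈ ℝ^{p×p} be a symmetric positive definite matrix with eigenvalues λ_1 ≥ λ_2 ≥ ⋯ ≥ λ_p > 0. Let γ ≥ 0 with γ ≠ 1 and let α ∈ ℝ with α ≠ 0 and α ≠ 2(1+γ)/λ_j for each 1 ≤ j ≤ p. Set Δ = (1+γ)I_p − αΣ and let Ω ∈ ℝ^{q×q} (q = Mp, M ≥ 3) be the M×M block matrix (with p×p blocks) whose (m,m) block is I_p, whose (m, m−1 mod M) block is −Δ, whose (m, m−2 mod M) block is γI_p, and whose remaining blocks are zero. Then Ω is invertible. -/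
set_option autoImplicit false

open Matrix Polynomial

/-- The `M × M` block matrix (with `p × p` blocks) whose `(m, m)` block is `I_p`,
whose `(m, m - 1 mod M)` block is `-Δ m`, whose `(m, m - 2 mod M)` block is `γ • I_p`,
and whose remaining blocks are zero. -/
def blockOmega (M p : ℕ) (γ : ℝ) (Δ : Fin M → Matrix (Fin p) (Fin p) ℝ) :
    Matrix (Fin M × Fin p) (Fin M × Fin p) ℝ :=
  Matrix.of fun x y =>
    if (y.1 : ℕ) = (x.1 : ℕ) then (1 : Matrix (Fin p) (Fin p) ℝ) x.2 y.2
    else if (y.1 : ℕ) = ((x.1 : ℕ) + (M - 1)) % M then -(Δ x.1 x.2 y.2)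
    else if (y.1 : ℕ) = ((x.1 : ℕ) + (M - 2)) % M then
      γ * (1 : Matrix (Fin p) (Fin p) ℝ) x.2 y.2
    else 0

/-- A vector sequence indexed by a finite abelian group and satisfying the linear recurrence
`v m = D v (m - g) - γ v (m - 2g)` with `D` symmetric and `γ ≠ 1` is invariant under `2g`. -/
theorem recurrence_periodic {G ι : Type*} [Fintype G] [AddCommGroup G] [Fintype ι]
    {D : Matrix ι ι ℝ} (hD : D.IsSymm) {γ : ℝ} (hγ : γ ≠ 1) (g : G) {v : G → ι → ℝ}
    (h : ∀ m, v m - D *ᵥ v (m - g) + γ • v (m - g - g) = 0) (m : G) :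
    v (m - g - g) = v m := by
  have shift (f : G → ℝ) : ∑ m, f (m - g) = ∑ m, f m := Equiv.sum_comp (Equiv.subRight g) f
  have hsq : ∑ m, v (m - g - g) ⬝ᵥ v (m - g - g) = ∑ m, v m ⬝ᵥ v m := by
    rw [shift fun m => v (m - g) ⬝ᵥ v (m - g), shift fun m => v m ⬝ᵥ v m]
  have hcross : ∑ m, v (m - g - g) ⬝ᵥ D *ᵥ v (m - g) = ∑ m, v m ⬝ᵥ D *ᵥ v (m - g) := by
    rw [shift fun m => v (m - g) ⬝ᵥ D *ᵥ v m]
    refine Finset.sum_congr rfl fun m _ => ?_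
    rw [dotProduct_mulVec, ← mulVec_transpose, hD.eq, dotProduct_comm]
  have h₀ : ∑ m, v m ⬝ᵥ v m - ∑ m, v m ⬝ᵥ D *ᵥ v (m - g)
      + γ * ∑ m, v m ⬝ᵥ v (m - g - g) = 0 := by
    rw [Finset.mul_sum, ← Finset.sum_sub_distrib, ← Finset.sum_add_distrib]
    refine Finset.sum_eq_zero fun m _ => ?_
    simpa [dotProduct_add, dotProduct_sub] using congrArg (v m ⬝ᵥ ·) (h m)
  have h₂ : ∑ m, v m ⬝ᵥ v (m - g - g) - ∑ m, v (m - g - g) ⬝ᵥ D *ᵥ v (m - g)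
      + γ * ∑ m, v (m - g - g) ⬝ᵥ v (m - g - g) = 0 := by
    rw [Finset.mul_sum, ← Finset.sum_sub_distrib, ← Finset.sum_add_distrib]
    refine Finset.sum_eq_zero fun m _ => ?_
    rw [dotProduct_comm (v m)]
    simpa [dotProduct_add, dotProduct_sub] using congrArg (v (m - g - g) ⬝ᵥ ·) (h m)
  rw [hsq, hcross] at h₂
  have hcorr : ∑ m, v m ⬝ᵥ v (m - g - g) = ∑ m, v m ⬝ᵥ v m :=
    mul_left_cancel₀ (sub_ne_zero.2 hγ) (by linear_combination h₀ - h₂)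
  have hdist : ∑ m, (v (m - g - g) - v m) ⬝ᵥ (v (m - g - g) - v m) = 0 := by
    simp only [sub_dotProduct, dotProduct_sub, Finset.sum_sub_distrib,
      dotProduct_comm (v (_ - g - g)) (v _), hsq]
    rw [hcorr]
    ring
  have hnonneg (w : ι → ℝ) : 0 ≤ w ⬝ᵥ w := Finset.sum_nonneg fun i _ => mul_self_nonneg (w i)
  have hm := (Finset.sum_eq_zero_iff_of_nonneg fun m _ => hnonneg _).1 hdist m (Finset.mem_univ m)
  exact sub_eq_zero.1 (dotProduct_self_eq_zero.1 hm)

/-- If moreover neither `1 + γ` nor `-(1 + γ)` is an eigenvalue of `D`, the sequence vanishes. -/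
theorem recurrence_eq_zero {G ι : Type*} [Fintype G] [AddCommGroup G] [Fintype ι]
    {D : Matrix ι ι ℝ} (hD : D.IsSymm) {γ : ℝ} (hγ : γ ≠ 1)
    (hadd : ∀ w, D *ᵥ w = (1 + γ) • w → w = 0)
    (hsub : ∀ w, D *ᵥ w = -(1 + γ) • w → w = 0) (g : G) {v : G → ι → ℝ}
    (h : ∀ m, v m - D *ᵥ v (m - g) + γ • v (m - g - g) = 0) (m : G) : v m = 0 := by
  have hper := recurrence_periodic hD hγ g h
  have step (m : G) : D *ᵥ v (m - g) = (1 + γ) • v m := by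
    have := h m
    rw [hper] at this
    linear_combination (norm := module) -this
  have step' : D *ᵥ v m = (1 + γ) • v (m - g) := by rw [← hper m, step]
  have hs := hadd (v m + v (m - g)) (by rw [mulVec_add, step, step']; module)
  have hd := hsub (v m - v (m - g)) (by rw [mulVec_sub, step, step']; module)
  have h2 : (2 : ℝ) • v m = 0 := by linear_combination (norm := module) hs + hd
  simpa using h2

/-- A number at which the characteristic polynomial does not vanish is not an eigenvalue. -/
theorem eq_zero_of_mulVec_eq_smul {ι K : Type*} [Fintype ι] [DecidableEq ι] [Field K]
    {A : Matrix ι ι K} {μ : K} (hμ : A.charpoly.eval μ ≠ 0) {w : ι → K}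
    (hw : A *ᵥ w = μ • w) : w = 0 := by
  rw [eval_charpoly] at hμ
  refine eq_zero_of_mulVec_eq_zero hμ ?_
  rw [sub_mulVec, hw, scalar_apply, ← smul_one_eq_diagonal, smul_mulVec, one_mulVec,
    sub_self]

/-- The action of `blockOmega` on a block vector. -/
theorem blockOmega_mulVec {n p : ℕ} (γ : ℝ)
    (Δ : Fin (n + 3) → Matrix (Fin p) (Fin p) ℝ) (v : Fin (n + 3) × Fin p → ℝ)
    (m : Fin (n + 3)) (i : Fin p) :
    (blockOmega (n + 3) p γ Δ *ᵥ v) (m, i) =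
      v (m, i) - (Δ m *ᵥ fun j => v (m - 1, j)) i + γ * v (m - 1 - 1, i) := by
  have h₁ (k : Fin (n + 3)) : (k : ℕ) = ((m : ℕ) + (n + 3 - 1)) % (n + 3) ↔ k = m - 1 := by
    rw [Fin.ext_iff, Fin.sub_def]
    simp [add_comm]
  have hadd : (1 : Fin (n + 3)) + 1 = 2 := by
    rw [Fin.ext_iff, Fin.val_add]
    simp [Nat.mod_eq_of_lt]
  have h₂ (k : Fin (n + 3)) : (k : ℕ) = ((m : ℕ) + (n + 3 - 2)) % (n + 3) ↔ k = m - 1 - 1 := by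
    rw [sub_sub, hadd, Fin.ext_iff, Fin.sub_def]
    simp [add_comm, Nat.mod_eq_of_lt]
  have htwo : (1 : Fin (n + 3)) + 1 ≠ 0 := by
    simp [Fin.ext_iff, Fin.val_add, Nat.mod_eq_of_lt]
  have hne₁ : m - 1 ≠ m := by simp
  have hne₂ : m - 1 - 1 ≠ m := by rw [sub_sub]; simpa using htwo
  have hne₃ : m - 1 - 1 ≠ m - 1 := by simp
  have key (k : Fin (n + 3)) (j : Fin p) : blockOmega (n + 3) p γ Δ (m, i) (k, j) * v (k, j) =
      (if k = m then (1 : Matrix (Fin p) (Fin p) ℝ) i j * v (m, j) else 0)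
      - (if k = m - 1 then Δ m i j * v (m - 1, j) else 0)
      + (if k = m - 1 - 1 then γ * ((1 : Matrix (Fin p) (Fin p) ℝ) i j * v (m - 1 - 1, j))
        else 0) := by
    simp only [blockOmega, of_apply, h₁, h₂, ← Fin.ext_iff]
    by_cases hk : k = m
    · subst hk
      simp [hne₁.symm, hne₂.symm]
    by_cases hk₁ : k = m - 1
    · subst hk₁
      simp [hne₁, hne₃.symm]
    by_cases hk₂ : k = m - 1 - 1
    · subst hk₂
      simp [hne₂, hne₃, mul_assoc]
    simp [hk, hk₁, hk₂]
  rw [mulVec, dotProduct, Fintype.sum_prod_type_right]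
  simp_rw [key, Finset.sum_add_distrib, Finset.sum_sub_distrib, Finset.sum_ite_eq',
    Finset.mem_univ, if_true, ← Finset.mul_sum]
  simp [one_apply, mulVec, dotProduct]

/-- For a symmetric positive definite `Σ` with eigenvalues
`λ_1 ≥ ⋯ ≥ λ_p > 0`, if `γ ≥ 0`, `γ ≠ 1`, `α ≠ 0` and `α ≠ 2(1+γ)/λ_j` for all `j`,
then the block matrix `Ω` built from `Δ = (1+γ)I_p - αΣ` is invertible. -/
theorem stmt0 (p M : ℕ) (hp : 1 ≤ p) (hM : 3 ≤ M)
    (S : Matrix (Fin p) (Fin p) ℝ) (hsymm : S.IsSymm)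
    (lam : Fin p → ℝ) (hmono : Antitone lam) (hpos : ∀ j, 0 < lam j)
    (hchar : S.charpoly = ∏ j : Fin p, (X - C (lam j)))
    (γ α : ℝ) (hγ0 : 0 ≤ γ) (hγ1 : γ ≠ 1) (hα0 : α ≠ 0)
    (halpha : ∀ j : Fin p, α ≠ 2 * (1 + γ) / lam j) :
    IsUnit (blockOmega M p γ
      (fun _ => (1 + γ) • (1 : Matrix (Fin p) (Fin p) ℝ) - α • S)) := by
  obtain ⟨n, rfl⟩ := Nat.exists_eq_add_of_le' hM
  have heval (μ : ℝ) (hμ : ∀ j, μ ≠ lam j) : S.charpoly.eval μ ≠ 0 := by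
    rw [hchar, eval_prod]
    exact Finset.prod_ne_zero_iff.2 fun j _ => by simpa [sub_eq_zero] using hμ j
  have hD : ((1 + γ) • (1 : Matrix (Fin p) (Fin p) ℝ) - α • S).IsSymm :=
    (isSymm_one.smul _).sub (hsymm.smul _)
  rw [isUnit_iff_isUnit_det, isUnit_iff_ne_zero]
  intro hdet
  obtain ⟨v, hv, hΩ⟩ := exists_mulVec_eq_zero_iff.2 hdet
  refine hv (funext fun x => ?_)
  refine congrFun (recurrence_eq_zero hD hγ1 ?_ ?_ 1 (v := fun m i => v (m, i)) ?_ x.1) x.2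
  · intro w hw
    refine eq_zero_of_mulVec_eq_smul (heval 0 fun j => (hpos j).ne) ?_
    rw [sub_mulVec, smul_mulVec, smul_mulVec, one_mulVec, sub_eq_self] at hw
    rw [(smul_eq_zero.1 hw).resolve_left hα0, zero_smul]
  · intro w hw
    refine eq_zero_of_mulVec_eq_smul (heval (2 * (1 + γ) / α) fun j hj => halpha j ?_) ?_
    · rw [← hj, div_div_cancel₀ (by positivity)]
    · rw [sub_mulVec, smul_mulVec, smul_mulVec, one_mulVec] at hw
      refine smul_right_injective _ hα0 ?_
      simp only [smul_smul, mul_div_cancel₀ _ hα0]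
      linear_combination (norm := module) -hw
  · intro m
    funext i
    have := congrFun hΩ (m, i)
    rw [blockOmega_mulVec] at this
    simpa using this
end

section
/- Let M ≥ 1, λ > 0, γ ≥ 0 with γ ≠ 1, and α ∈ ℝ with αλ ≠ 0 and αλ ≠ 2(1+γ). Then no complex number ω with ω^M = 1 satisfies the quadratic equation ω² + (αλ − 1 − γ)ω + γ = 0. -/
set_option autoImplicit false

/-- Let `M ≥ 1`, `λ > 0`, `γ ≥ 0` with `γ ≠ 1`, and `α ∈ ℝ` with
`αλ ≠ 0` and `αλ ≠ 2(1+γ)`. Then no complex `M`-th root of unity `ω` satisfies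
`ω² + (αλ − 1 − γ)ω + γ = 0`. -/
theorem stmt1 (M : ℕ) (hM : 1 ≤ M) (lam γ α : ℝ) (hlam : 0 < lam)
    (hγ0 : 0 ≤ γ) (hγ1 : γ ≠ 1) (h1 : α * lam ≠ 0) (h2 : α * lam ≠ 2 * (1 + γ)) :
    ∀ ω : ℂ, ω ^ M = 1 →
      ω ^ 2 + (((α * lam - 1 - γ : ℝ)) : ℂ) * ω + ((γ : ℝ) : ℂ) ≠ 0 := by
  intro ω hω h
  have hnorm : ω.re ^ 2 + ω.im ^ 2 = 1 := by
    have h' : ‖ω‖ = 1 := Complex.norm_eq_one_of_pow_eq_one hω (by omega)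
    have hsq := Complex.sq_norm ω
    rw [h', Complex.normSq_apply] at hsq
    linarith
  have hre := congrArg Complex.re h
  have him := congrArg Complex.im h
  simp only [pow_two, Complex.add_re, Complex.add_im, Complex.mul_re, Complex.mul_im,
    Complex.ofReal_re, Complex.ofReal_im, Complex.zero_re, Complex.zero_im] at hre him
  have hfactor : ω.im * (2 * ω.re + (α * lam - 1 - γ)) = 0 := by linarith
  rcases mul_eq_zero.mp hfactor with hb | hc
  · rw [hb] at hnorm hre
    rcases eq_or_eq_neg_of_sq_eq_sq ω.re 1 (by linarith) with ha | ha
    · apply h1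
      rw [ha] at hre
      linarith
    · apply h2
      rw [ha] at hre
      linarith
  · apply hγ1
    linear_combination hre - ω.re * hc + hnorm
end

section
/- Let p ≥ 1 and let Σ ∈ ℝ^{p×p} be a symmetric positive definite matrix with eigenvalues λ_1 ≥ λ_2 ≥ ⋯ ≥ λ_p > 0. For real numbers α and γ with 0 < γ < 1 and 0 < α < 2(1+γ)/λ_1, set Δ = (1+γ)I_p − αΣ and define the block matrix D = [Δ, −γI_p; I_p, 0] ∈ ℝ^{(2p)×(2p)}. Then every real eigenvalue ξ of D satisfies ξ ∈ (γ, 1) ∪ (−1, −γ). -/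
set_option autoImplicit false

open Matrix Polynomial

/-- The heavy-ball block matrix `D = [Δ, −γ I_p; I_p, 0]` with `Δ = (1+γ) I_p − α Σ`. -/
noncomputable def hbMat {p : ℕ} (γ α : ℝ) (S : Matrix (Fin p) (Fin p) ℝ) :
    Matrix (Fin p ⊕ Fin p) (Fin p ⊕ Fin p) ℝ :=
  Matrix.fromBlocks ((1 + γ) • 1 - α • S) (-(γ • (1 : Matrix (Fin p) (Fin p) ℝ))) 1 0

/-- A real number in the complex spectrum of a real matrix has a real eigenvector. -/
theorem exists_mulVec_eq_smul_of_mem_spectrum_map {n : Type*} [Fintype n] [DecidableEq n]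
    {M : Matrix n n ℝ} {ξ : ℝ} (h : (ξ : ℂ) ∈ spectrum ℂ (M.map Complex.ofReal)) :
    ∃ v : n → ℝ, v ≠ 0 ∧ M *ᵥ v = ξ • v := by
  have hroot : (M.map Complex.ofRealHom).charpoly.IsRoot (Complex.ofRealHom ξ) :=
    Matrix.mem_spectrum_iff_isRoot_charpoly.mp h
  rw [Matrix.charpoly_map, Polynomial.IsRoot, Polynomial.eval_map_apply, map_eq_zero,
    Matrix.eval_charpoly] at hroot
  obtain ⟨v, hv, hMv⟩ := Matrix.exists_mulVec_eq_zero_iff.mpr hroot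
  refine ⟨v, hv, ?_⟩
  rw [Matrix.sub_mulVec, sub_eq_zero] at hMv
  rw [← hMv]
  ext i
  simp [Matrix.scalar_apply, Matrix.mulVec_diagonal]

/-- An eigenvalue of a matrix is a root of its characteristic polynomial. -/
theorem charpoly_isRoot_of_mulVec_eq_smul {n : Type*} [Fintype n] [DecidableEq n]
    {M : Matrix n n ℝ} {μ : ℝ} {v : n → ℝ} (hv : v ≠ 0) (h : M *ᵥ v = μ • v) :
    M.charpoly.IsRoot μ := by
  rw [Polynomial.IsRoot, Matrix.eval_charpoly]
  refine Matrix.exists_mulVec_eq_zero_iff.mp ⟨v, hv, ?_⟩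
  rw [Matrix.sub_mulVec, h, sub_eq_zero]
  ext i
  simp [Matrix.scalar_apply, Matrix.mulVec_diagonal]

/-- A real eigenvalue of the heavy-ball matrix solves the scalar heavy-ball quadratic for some
eigenvalue `μ` of `S`. -/
theorem exists_isRoot_charpoly_of_hbMat_mulVec {p : ℕ} {S : Matrix (Fin p) (Fin p) ℝ}
    {α γ ξ : ℝ} (hα : α ≠ 0) (hγ : γ ≠ 0) {v : Fin p ⊕ Fin p → ℝ} (hv : v ≠ 0)
    (h : hbMat γ α S *ᵥ v = ξ • v) :
    ∃ μ : ℝ, S.charpoly.IsRoot μ ∧ ξ ^ 2 - (1 + γ - α * μ) * ξ + γ = 0 := by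
  have hlow : ∀ i, v (Sum.inl i) = ξ * v (Sum.inr i) := fun i => by
    simpa [hbMat, Matrix.fromBlocks_mulVec] using congrFun h (Sum.inr i)
  set w : Fin p → ℝ := fun i => v (Sum.inr i)
  have hlow' : v ∘ Sum.inl = ξ • w := funext hlow
  have hw : w ≠ 0 := by
    intro hw
    refine hv (funext fun i => ?_)
    rcases i with i | i
    · simpa [hw] using congrFun hlow' i
    · exact congrFun hw i
  have hup : ∀ i, (1 + γ) * (ξ * w i) - α * (ξ * (S *ᵥ w) i) - γ * w i = ξ * (ξ * w i) := by
    intro i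
    have hi := congrFun h (Sum.inl i)
    simp only [hbMat, Matrix.fromBlocks_mulVec, Sum.elim_inl, hlow', Pi.add_apply, Pi.smul_apply,
      smul_eq_mul, hlow i, Matrix.sub_mulVec, Matrix.neg_mulVec, Matrix.smul_mulVec,
      Matrix.one_mulVec, Matrix.mulVec_smul, Pi.sub_apply, Pi.neg_apply, Function.comp_apply]
      at hi
    linarith
  have hξ : ξ ≠ 0 := by
    rintro rfl
    refine hw (funext fun i => ?_)
    simpa [hγ] using hup i
  refine ⟨((1 + γ) * ξ - γ - ξ ^ 2) / (α * ξ),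
    charpoly_isRoot_of_mulVec_eq_smul hw (funext fun i => ?_), ?_⟩
  · rw [Pi.smul_apply, smul_eq_mul]
    field_simp
    linarith [hup i]
  · field_simp
    ring

/-- For a symmetric positive definite `Σ` with eigenvalues
`λ_1 ≥ ⋯ ≥ λ_p > 0`, `0 < γ < 1` and `0 < α < 2(1+γ)/λ_1`, every real eigenvalue `ξ`
of `D` lies in `(γ, 1) ∪ (−1, −γ)`. -/
theorem stmt9 (p : ℕ) (hp : 1 ≤ p)
    (S : Matrix (Fin p) (Fin p) ℝ) (hsymm : S.IsSymm)
    (lam : Fin p → ℝ) (hmono : Antitone lam) (hpos : ∀ j, 0 < lam j)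
    (hchar : S.charpoly = ∏ j : Fin p, (X - C (lam j)))
    (α γ : ℝ) (hγ0 : 0 < γ) (hγ1 : γ < 1) (hα : 0 < α)
    (hup : α < 2 * (1 + γ) / lam ⟨0, hp⟩) :
    ∀ ξ : ℝ, ((ξ : ℂ) ∈ spectrum ℂ ((hbMat γ α S).map Complex.ofReal)) →
      ξ ∈ Set.Ioo γ 1 ∪ Set.Ioo (-1) (-γ) := by
  intro ξ hξ
  obtain ⟨v, hv, hDv⟩ := exists_mulVec_eq_smul_of_mem_spectrum_map hξ
  obtain ⟨μ, hμ, hquad⟩ := exists_isRoot_charpoly_of_hbMat_mulVec hα.ne' hγ0.ne' hv hDv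
  obtain ⟨j, rfl⟩ : ∃ j, μ = lam j := by
    simpa [hchar, Polynomial.IsRoot, Polynomial.eval_prod, Finset.prod_eq_zero_iff,
      sub_eq_zero] using hμ
  have hlow : 0 < α * lam j := mul_pos hα (hpos j)
  have hupp : α * lam j < 2 * (1 + γ) :=
    (mul_le_mul_of_nonneg_left (hmono (Fin.mk_le_of_le_val (Nat.zero_le _))) hα.le).trans_lt
      ((lt_div_iff₀ (hpos _)).mp hup)
  rcases lt_trichotomy ξ 0 with hneg | rfl | hξ_pos
  · right
    have hprod : (ξ + 1) * (ξ + γ) < 0 := by nlinarith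
    constructor <;> nlinarith
  · simp [hγ0.ne'] at hquad
  · left
    have hprod : (ξ - 1) * (ξ - γ) < 0 := by nlinarith
    constructor <;> nlinarith
end

section
/- Let p ≥ 1, let Σ̂ ∈ ℝ^{p×p} be a symmetric positive definite matrix with largest eigenvalue λ_max, and let b ∈ ℝ^p. Let 0 ≤ γ < 1 and 0 < α < 2(1+γ)/λ_max. Define a sequence (θ^{(t)})_{t ≥ 1} by the heavy-ball recursion θ^{(t)} = ((1+γ)I_p − αΣ̂)θ^{(t−1)} − γθ^{(t−2)} + αb, started from arbitrary θ^{(0)}, θ^{(−1)} ∈ ℝ^p. Then θ^{(t)} → Σ̂^{-1}b as t → ∞. -/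
set_option autoImplicit false

open Matrix Filter

/-- A complex root of `z ^ 2 - a z + c` lies in the open unit disc whenever the real coefficients
satisfy `c < 1` and `|a| < 1 + c`. -/
lemma norm_root_lt_one {a c : ℝ} (hc1 : c < 1) (ha : |a| < 1 + c) {r s : ℂ}
    (hadd : r + s = a) (hmul : r * s = c) : ‖r‖ < 1 := by
  by_contra! hr
  have hsq : 1 ≤ r.re ^ 2 + r.im ^ 2 := by
    have h : ‖r‖ ^ 2 = r.re ^ 2 + r.im ^ 2 := by
      rw [Complex.sq_norm, Complex.normSq_apply]; ring
    nlinarith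
  have hsre : s.re = a - r.re := by
    have h := congrArg Complex.re hadd
    simp only [Complex.add_re, Complex.ofReal_re] at h
    linarith
  have hsim : s.im = -r.im := by
    have h := congrArg Complex.im hadd
    simp only [Complex.add_im, Complex.ofReal_im] at h
    linarith
  have hre := congrArg Complex.re hmul
  have him := congrArg Complex.im hmul
  simp only [Complex.mul_re, Complex.mul_im, Complex.ofReal_re, Complex.ofReal_im, hsre, hsim]
    at hre him
  have hprod : r.im * (a - 2 * r.re) = 0 := by linarith
  rcases mul_eq_zero.mp hprod with h | h
  · rw [h] at hre hsq
    have habs : 1 ≤ |r.re| := by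
      rw [← one_le_sq_iff_one_le_abs]; linarith
    have hle : r.re * a ≤ |r.re| * |a| := (le_abs_self _).trans_eq (abs_mul _ _)
    nlinarith [sq_abs r.re]
  · have ha2 : a = 2 * r.re := by linarith
    subst ha2
    nlinarith

/-- A real second-order linear recurrence with coefficients in the stability region tends to
zero. -/
lemma tendsto_zero_of_second_order_recurrence {a c : ℝ} (hc1 : c < 1)
    (ha : |a| < 1 + c) {x : ℕ → ℝ} (hx : ∀ t, x (t + 2) = a * x (t + 1) - c * x t) :
    Tendsto x atTop (nhds 0) := by
  obtain ⟨r, s, hadd, hmul⟩ : ∃ r s : ℂ, r + s = a ∧ r * s = c := by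
    obtain ⟨d, hd⟩ := IsAlgClosed.exists_pow_nat_eq ((a : ℂ) ^ 2 - 4 * c) (n := 2) (by norm_num)
    exact ⟨(a + d) / 2, (a - d) / 2, by ring, by linear_combination -hd / 4⟩
  have hr := norm_root_lt_one hc1 ha hadd hmul
  have hs := norm_root_lt_one hc1 ha ((add_comm s r).trans hadd) ((mul_comm s r).trans hmul)
  obtain ⟨ρ, hρ, hρ1⟩ := exists_between (max_lt (max_lt hr hs) zero_lt_one)
  obtain ⟨hrsρ, hρ0⟩ := max_lt_iff.mp hρ
  obtain ⟨hrρ, hsρ⟩ := max_lt_iff.mp hrsρ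
  have hgeom : ∀ t, (x (t + 1) : ℂ) - r * x t = s ^ t * (x 1 - r * x 0) := by
    intro t
    induction t with
    | zero => simp
    | succ t ih =>
      rw [pow_succ', mul_assoc, ← ih, hx]
      push_cast
      rw [← hadd, ← hmul]
      ring
  set D := ‖(x 1 : ℂ) - r * x 0‖
  have hbound : ∀ t : ℕ, ‖(x t : ℂ)‖ ≤ ‖(x 0 : ℂ)‖ * ρ ^ t + D / ρ * (t * ρ ^ t) := by
    intro t
    induction t with
    | zero => simp
    | succ t ih =>
      have hstep : (x (t + 1) : ℂ) = r * x t + s ^ t * (x 1 - r * x 0) := by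
        linear_combination hgeom t
      calc ‖(x (t + 1) : ℂ)‖ ≤ ‖r‖ * ‖(x t : ℂ)‖ + ‖s‖ ^ t * D := by
            rw [hstep]
            refine (norm_add_le _ _).trans_eq ?_
            rw [norm_mul, norm_mul, norm_pow]
        _ ≤ ρ * (‖(x 0 : ℂ)‖ * ρ ^ t + D / ρ * (t * ρ ^ t)) + ρ ^ t * D := by gcongr
        _ = ‖(x 0 : ℂ)‖ * ρ ^ (t + 1) + D / ρ * ((t + 1 : ℕ) * ρ ^ (t + 1)) := by
            push_cast
            field_simp
            ring
  refine squeeze_zero_norm (fun t => by simpa using hbound t) ?_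
  simpa using ((tendsto_pow_atTop_nhds_zero_of_lt_one hρ0.le hρ1).const_mul _).add
    ((tendsto_self_mul_const_pow_of_lt_one hρ0.le hρ1).const_mul (D / ρ))

/-- A sequence of vectors tends to zero if its coordinates in an orthonormal basis do. -/
lemma tendsto_zero_of_dotProduct_orthonormalBasis {ι : Type*} [Fintype ι]
    (v : OrthonormalBasis ι ℝ (EuclideanSpace ℝ ι)) {e : ℕ → ι → ℝ}
    (h : ∀ i, Tendsto (fun t => (v i).ofLp ⬝ᵥ e t) atTop (nhds 0)) :
    Tendsto e atTop (nhds 0) := by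
  have hsum : ∀ t, e t = ∑ i, ((v i).ofLp ⬝ᵥ e t) • (v i).ofLp := by
    intro t
    have h := congrArg WithLp.ofLp (v.sum_repr' (WithLp.toLp 2 (e t)))
    simpa [EuclideanSpace.inner_eq_star_dotProduct, dotProduct_comm] using h.symm
  rw [funext hsum]
  simpa using tendsto_finsetSum Finset.univ fun i _ => (h i).smul_const (v i).ofLp

/-- Heavy-ball convergence for a quadratic loss: if `Σ̂` is symmetric
positive definite with largest eigenvalue `λ_max`, `0 ≤ γ < 1`, and
`0 < α < 2(1+γ)/λ_max`, then the heavy-ball iterates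
`θ^{(t)} = ((1+γ)I_p − αΣ̂)θ^{(t−1)} − γθ^{(t−2)} + αb` converge to `Σ̂⁻¹ b` from any
starting values.  Here `θ (t)` denotes `θ^{(t-1)}`, so that `θ 0, θ 1` are the
arbitrary initial values `θ^{(−1)}, θ^{(0)}`. -/
theorem stmt10 (p : ℕ) (hp : 1 ≤ p)
    (S : Matrix (Fin p) (Fin p) ℝ) (hpd : S.PosDef)
    (lamMax : ℝ) (hmem : lamMax ∈ spectrum ℝ S)
    (hmax : ∀ μ ∈ spectrum ℝ S, μ ≤ lamMax)
    (b : Fin p → ℝ) (γ α : ℝ) (hγ0 : 0 ≤ γ) (hγ1 : γ < 1)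
    (hα0 : 0 < α) (hα1 : α < 2 * (1 + γ) / lamMax)
    (θ : ℕ → (Fin p → ℝ))
    (hrec : ∀ t : ℕ,
      θ (t + 2) = ((1 + γ) • (1 : Matrix (Fin p) (Fin p) ℝ) - α • S).mulVec (θ (t + 1))
        - γ • θ t + α • b) :
    Tendsto θ atTop (nhds (S⁻¹.mulVec b)) := by
  set e : ℕ → Fin p → ℝ := fun t => θ t - S⁻¹ *ᵥ b with he
  have hfix : S *ᵥ (S⁻¹ *ᵥ b) = b := by
    rw [mulVec_mulVec, mul_nonsing_inv S ((isUnit_iff_isUnit_det S).mp hpd.isUnit), one_mulVec]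
  have herec : ∀ t, e (t + 2) = (1 + γ) • e (t + 1) - α • (S *ᵥ e (t + 1)) - γ • e t := by
    intro t
    simp only [he, hrec, sub_mulVec, smul_mulVec, one_mulVec, mulVec_sub, hfix]
    module
  suffices h : Tendsto e atTop (nhds 0) by
    simpa [he] using h.add_const (S⁻¹ *ᵥ b)
  refine tendsto_zero_of_dotProduct_orthonormalBasis hpd.isHermitian.eigenvectorBasis fun i => ?_
  set μ := hpd.isHermitian.eigenvalues i
  have hμ0 : 0 < μ := hpd.eigenvalues_pos i
  have hμle : μ ≤ lamMax := hmax _ (hpd.isHermitian.eigenvalues_mem_spectrum_real i)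
  have hα2 : α * lamMax < 2 * (1 + γ) := (lt_div_iff₀ (hμ0.trans_le hμle)).mp hα1
  have hstable : |1 + γ - α * μ| < 1 + γ := by
    rw [abs_lt]
    constructor <;> nlinarith
  refine tendsto_zero_of_second_order_recurrence hγ1 hstable fun t => ?_
  have hsymm : Sᵀ = S := by simpa [conjTranspose_eq_transpose_of_trivial] using hpd.isHermitian.eq
  have heig : (hpd.isHermitian.eigenvectorBasis i).ofLp ⬝ᵥ (S *ᵥ e (t + 1)) =
      μ * ((hpd.isHermitian.eigenvectorBasis i).ofLp ⬝ᵥ e (t + 1)) := by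
    rw [dotProduct_mulVec, ← mulVec_transpose, hsymm, hpd.isHermitian.mulVec_eigenvectorBasis,
      smul_dotProduct, smul_eq_mul]
  rw [herec, dotProduct_sub, dotProduct_sub, dotProduct_smul, dotProduct_smul, dotProduct_smul,
    heig]
  simp only [smul_eq_mul]
  ring
end

section
/- Let M ≥ 3, p ≥ 1, q = Mp, and γ ≥ 0 with γ ≠ 1. Let A ∈ ℝ^{q×q} be the M×M block matrix (p×p blocks) whose (m,m) block is I_p, whose (m, m−1 mod M) block is −(1+γ)I_p, whose (m, m−2 mod M) block is γI_p, and whose remaining blocks are zero. Let Σ̂^{(1)}, …, Σ̂^{(M)} ∈ ℝ^{p×p} be symmetric positive semidefinite matrices whose average Σ̂ = M^{-1}∑_{m=1}^M Σ̂^{(m)} is invertible, let B̂ ∈ ℝ^{q×q} be the block matrix whose (m, m−1 mod M) block is Σ̂^{(m)} and whose other blocks are zero, and set Ω(α) = A + αB̂ for α ∈ ℝ. Let b^{(1)}, …, b^{(M)} ∈ ℝ^p, b* = (b^{(1)ᵀ}, …, b^{(M)ᵀ})ᵀ, θ̂_ols = Σ̂^{-1}(M^{-1}∑_{m} b^{(m)}),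 and θ*_ols = 1_M ⊗ θ̂_ols. Let P_1 = M^{-1/2} 1_M ⊗ I_p ∈ ℝ^{q×p} and let P_2 ∈ ℝ^{q×(q−p)} be any matrix with P_2ᵀP_2 = I_{q−p} and P_2ᵀP_1 = 0. Then A_{22} := P_2ᵀAP_2 is invertible, and there exist α_0 > 0 and C > 0 such that for every 0 < α < α_0, Ω(α) is invertible and ‖αΩ(α)^{-1}b* − θ*_ols − αÊ‖ ≤ Cα², where Ê = (P_1Σ̂^{-1}P_1ᵀB̂ − I_q) P_2A_{22}^{-1}P_2ᵀ (B̂θ*_ols − b*). -/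
set_option autoImplicit false

open Matrix Polynomial

/-- The `M × M` block matrix `A` (with `p × p` blocks) whose `(m, m)` block is `I_p`,
whose `(m, m - 1 mod M)` block is `-(1+γ) I_p`, whose `(m, m - 2 mod M)` block is
`γ I_p`, and whose remaining blocks are zero. -/
def blockA (M p : ℕ) (γ : ℝ) : Matrix (Fin M × Fin p) (Fin M × Fin p) ℝ :=
  Matrix.of fun x y =>
    if (y.1 : ℕ) = (x.1 : ℕ) then (1 : Matrix (Fin p) (Fin p) ℝ) x.2 y.2
    else if (y.1 : ℕ) = ((x.1 : ℕ) + (M - 1)) % M then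
      -((1 + γ) * (1 : Matrix (Fin p) (Fin p) ℝ) x.2 y.2)
    else if (y.1 : ℕ) = ((x.1 : ℕ) + (M - 2)) % M then
      γ * (1 : Matrix (Fin p) (Fin p) ℝ) x.2 y.2
    else 0

/-- The `M × M` block matrix `B̂` whose `(m, m - 1 mod M)` block is `Σ̂^{(m)}` and whose
other blocks are zero. -/
def blockB (M p : ℕ) (Shat : Fin M → Matrix (Fin p) (Fin p) ℝ) :
    Matrix (Fin M × Fin p) (Fin M × Fin p) ℝ :=
  Matrix.of fun x y =>
    if (y.1 : ℕ) = ((x.1 : ℕ) + (M - 1)) % M then Shat x.1 x.2 y.2 else 0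

/-- The Euclidean norm of a vector. -/
noncomputable def eNorm {n : Type*} [Fintype n] (v : n → ℝ) : ℝ :=
  Real.sqrt (∑ i, (v i) ^ 2)


lemma continuous_eNorm {n : Type*} [Fintype n] : Continuous (eNorm : (n → ℝ) → ℝ) := by
  unfold eNorm
  fun_prop

lemma eNorm_nonneg {n : Type*} [Fintype n] (v : n → ℝ) : 0 ≤ eNorm v := Real.sqrt_nonneg _

lemma eNorm_sq_smul {n : Type*} [Fintype n] (a : ℝ) (v : n → ℝ) :
    eNorm (a ^ 2 • v) = a ^ 2 * eNorm v := by
  simp only [eNorm, Pi.smul_apply, smul_eq_mul, mul_pow (a ^ 2), ← Finset.mul_sum]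
  rw [Real.sqrt_mul (by positivity), Real.sqrt_sq (by positivity)]

section PerturbedInverse

variable {n : Type*} [Fintype n] [DecidableEq n]

/-- If `A * S = 0` and `A * T = -Q`, where `Q` fixes `B * T` and `1 - B * S` from the left, then
`A + α • B` has an explicit right inverse, singular in `α` only through `α⁻¹ • S`. -/
lemma add_smul_mul_eq_one {A B Q S T K : Matrix n n ℝ} {α : ℝ} (hα : α ≠ 0)
    (hAS : A * S = 0) (hAT : A * T = -Q) (hQT : Q * (B * T) = B * T)
    (hQS : Q * (1 - B * S) = 1 - B * S) (hK : (1 - α • (B * T)) * K = 1) :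
    (A + α • B) * (α⁻¹ • S - T * K * (1 - B * S)) = 1 := by
  have hT : (A + α • B) * T = -(Q * (1 - α • (B * T))) := by
    rw [add_mul, hAT, smul_mul_assoc, mul_sub, mul_smul_comm, hQT, mul_one]
    abel
  have hTK : (A + α • B) * (T * K) = -Q := by
    rw [← mul_assoc, hT, neg_mul, mul_assoc, hK, mul_one]
  have hS : (A + α • B) * (α⁻¹ • S) = B * S := by
    rw [add_mul, mul_smul_comm, hAS, smul_mul_smul_comm, mul_inv_cancel₀ hα]
    simp
  rw [mul_sub, hS, ← mul_assoc, hTK, neg_mul, hQS]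
  abel

/-- The second-order remainder of `α (A + α • B)⁻¹ b` in the setting of `add_smul_mul_eq_one`. -/
lemma smul_inv_add_smul_mulVec {A B Q S T : Matrix n n ℝ} {α : ℝ} (hα : α ≠ 0)
    (hAS : A * S = 0) (hAT : A * T = -Q) (hQT : Q * (B * T) = B * T)
    (hQS : Q * (1 - B * S) = 1 - B * S) (hK : IsUnit (1 - α • (B * T)).det) (b : n → ℝ) :
    α • ((A + α • B)⁻¹ *ᵥ b) - S *ᵥ b - α • (T *ᵥ (B *ᵥ (S *ᵥ b) - b)) =
      α ^ 2 • ((T * (1 - α • (B * T))⁻¹ * (B * T)) *ᵥ (B *ᵥ (S *ᵥ b) - b)) := by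
  have hK' := Matrix.mul_nonsing_inv _ hK
  have hK'' := Matrix.nonsing_inv_mul _ hK
  rw [Matrix.inv_eq_right_inv (add_smul_mul_eq_one hα hAS hAT hQT hQS hK')]
  generalize (1 - α • (B * T))⁻¹ = K at *
  have hw : B *ᵥ (S *ᵥ b) - b = -((1 - B * S) *ᵥ b) := by
    rw [Matrix.sub_mulVec, Matrix.one_mulVec, Matrix.mulVec_mulVec, neg_sub]
  have hKN : K = 1 + α • (K * (B * T)) := by
    rw [mul_sub, mul_one, mul_smul_comm] at hK''
    exact sub_eq_iff_eq_add.mp hK''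
  have hTK : T * K = T + α • (T * K * (B * T)) := by
    conv_lhs => rw [hKN]
    rw [mul_add, mul_one, mul_smul_comm, mul_assoc]
  rw [hw, Matrix.sub_mulVec, ← Matrix.mulVec_mulVec _ (T * K)]
  generalize (1 - B * S) *ᵥ b = w
  have hTw : (T * K) *ᵥ w = T *ᵥ w + α • ((T * K * (B * T)) *ᵥ w) := by
    conv_lhs => rw [hTK]
    rw [Matrix.add_mulVec, Matrix.smul_mulVec]
  rw [hTw, Matrix.smul_mulVec, smul_sub, smul_smul, mul_inv_cancel₀ hα, one_smul,
    Matrix.mulVec_neg, Matrix.mulVec_neg, smul_add, smul_smul, sq]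
  simp only [smul_neg]
  abel

lemma exists_isUnit_det_and_eNorm_le (N L R : Matrix n n ℝ) (w : n → ℝ) :
    ∃ α₀ > (0 : ℝ), ∃ c > (0 : ℝ), ∀ α : ℝ, 0 < α → α < α₀ →
      IsUnit (1 - α • N).det ∧ eNorm ((L * (1 - α • N)⁻¹ * R) *ᵥ w) ≤ c := by
  have hM : Continuous fun α : ℝ => 1 - α • N := by fun_prop
  have h0 : (1 - (0 : ℝ) • N).det ≠ 0 := by simp
  have hinv : ContinuousAt (fun α : ℝ => (1 - α • N)⁻¹) 0 := by
    refine ContinuousAt.comp (g := Inv.inv) (continuousAt_matrix_inv _ ?_) hM.continuousAt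
    simpa only [Ring.inverse_eq_inv'] using continuousAt_inv₀ h0
  have hv : ContinuousAt (fun α : ℝ => eNorm ((L * (1 - α • N)⁻¹ * R) *ᵥ w)) 0 := by
    have hc : Continuous fun X : Matrix n n ℝ => eNorm ((L * X * R) *ᵥ w) :=
      continuous_eNorm.comp (by fun_prop)
    exact hc.continuousAt.comp hinv
  have he := (hM.matrix_det.continuousAt.eventually_ne h0).and
    (hv.eventually_lt_const (lt_add_one _))
  obtain ⟨ε, hε, h⟩ := Metric.eventually_nhds_iff.mp he
  refine ⟨ε, hε, eNorm ((L * (1 - (0 : ℝ) • N)⁻¹ * R) *ᵥ w) + 1,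
    add_pos_of_nonneg_of_pos (eNorm_nonneg _) one_pos, fun α hα hαε => ?_⟩
  obtain ⟨h1, h2⟩ := h (y := α) (by simpa [abs_of_pos hα] using hαε)
  exact ⟨isUnit_iff_ne_zero.mpr h1, h2.le⟩

end PerturbedInverse

section Blocks

variable {M p : ℕ} [NeZero M]

lemma Fin.val_eq_add_sub_mod_iff {k : ℕ} (hk : k < M) (x y : Fin M) :
    (y : ℕ) = (x + (M - k)) % M ↔ y = x - Fin.ofNat M k := by
  rw [Fin.ext_iff, Fin.sub_def, Fin.val_ofNat, Nat.mod_eq_of_lt hk, add_comm (x : ℕ)]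

lemma blockA_mulVec (hM : 3 ≤ M) (γ : ℝ) (v : Fin M × Fin p → ℝ) (m : Fin M) (i : Fin p) :
    (blockA M p γ *ᵥ v) (m, i) = v (m, i) - (1 + γ) * v (m - Fin.ofNat M 1, i) +
      γ * v (m - Fin.ofNat M 2, i) := by
  have h1 : m ≠ m - Fin.ofNat M 1 := fun h => by
    simpa [Fin.ext_iff, Nat.mod_eq_of_lt (show 1 < M by omega)] using (sub_eq_self.mp h.symm)
  have h2 : m ≠ m - Fin.ofNat M 2 := fun h => by
    simpa [Fin.ext_iff, Nat.mod_eq_of_lt (show 2 < M by omega)] using (sub_eq_self.mp h.symm)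
  have h12 : m - Fin.ofNat M 1 ≠ m - Fin.ofNat M 2 := fun h => by
    simpa [Fin.ext_iff, Nat.mod_eq_of_lt (show 1 < M by omega),
      Nat.mod_eq_of_lt (show 2 < M by omega)] using (sub_right_inj.mp h)
  have key (k : Fin M) : ∑ j, blockA M p γ (m, i) (k, j) * v (k, j) =
      (if k = m then v (m, i) else 0)
        + (if k = m - Fin.ofNat M 1 then -((1 + γ) * v (m - Fin.ofNat M 1, i)) else 0)
        + (if k = m - Fin.ofNat M 2 then γ * v (m - Fin.ofNat M 2, i) else 0) := by
    simp only [blockA, Matrix.of_apply, ← Fin.ext_iff,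
      Fin.val_eq_add_sub_mod_iff (show 1 < M by omega),
      Fin.val_eq_add_sub_mod_iff (show 2 < M by omega)]
    split_ifs <;> simp_all [Matrix.one_apply]
  simp only [Matrix.mulVec, dotProduct, Fintype.sum_prod_type, key, Finset.sum_add_distrib,
    Finset.sum_ite_eq', Finset.mem_univ, if_true]
  ring

lemma blockB_mulVec_const (hM : 3 ≤ M) (Shat : Fin M → Matrix (Fin p) (Fin p) ℝ)
    (θ : Fin p → ℝ) :
    blockB M p Shat *ᵥ (fun x => θ x.2) = fun x => (Shat x.1 *ᵥ θ) x.2 := by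
  ext ⟨m, i⟩
  have key (k : Fin M) : ∑ j, blockB M p Shat (m, i) (k, j) * θ j =
      if k = m - Fin.ofNat M 1 then (Shat m *ᵥ θ) i else 0 := by
    simp only [blockB, Matrix.of_apply, Fin.val_eq_add_sub_mod_iff (show 1 < M by omega)]
    split_ifs <;> simp [Matrix.mulVec, dotProduct]
  simp only [Matrix.mulVec, dotProduct, Fintype.sum_prod_type] at key ⊢
  simp [key]

lemma sum_blockA_mulVec (hM : 3 ≤ M) (γ : ℝ) (v : Fin M × Fin p → ℝ) (i : Fin p) :
    ∑ m, (blockA M p γ *ᵥ v) (m, i) = 0 := by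
  simp only [blockA_mulVec hM, Finset.sum_add_distrib, Finset.sum_sub_distrib, ← Finset.mul_sum]
  have h (c : Fin M) : ∑ m, v (m - c, i) = ∑ m, v (m, i) :=
    (Equiv.subRight c).sum_comp fun m => v (m, i)
  rw [h, h]
  ring

/-- The cyclic differences `d m = v m - v (m - 1)` of a kernel vector satisfy
`d m = γ * d (m - 1)`, hence vanish. -/
lemma eq_const_of_blockA_mulVec_eq_zero (hM : 3 ≤ M) {γ : ℝ} (hγ0 : 0 ≤ γ) (hγ1 : γ ≠ 1)
    {v : Fin M × Fin p → ℝ} (hv : blockA M p γ *ᵥ v = 0) (m : Fin M) (i : Fin p) :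
    v (m, i) = v (0, i) := by
  have h2 : Fin.ofNat M 2 = Fin.ofNat M 1 + Fin.ofNat M 1 := by
    simp [Fin.ext_iff, Fin.val_add]
  let d : Fin M → ℝ := fun m => v (m, i) - v (m - Fin.ofNat M 1, i)
  have hd (m : Fin M) : d m = γ * d (m - Fin.ofNat M 1) := by
    have h := congrFun hv (m, i)
    rw [blockA_mulVec hM, h2, ← sub_sub] at h
    simp only [Pi.zero_apply] at h
    simp only [d]
    linarith
  have hsum : ∑ m, d m ^ 2 = γ ^ 2 * ∑ m, d m ^ 2 := by
    calc ∑ m, d m ^ 2 = ∑ m, γ ^ 2 * d (m - Fin.ofNat M 1) ^ 2 :=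
          Finset.sum_congr rfl fun m _ => by rw [hd, mul_pow]
      _ = γ ^ 2 * ∑ m, d m ^ 2 := by
          rw [← Finset.mul_sum]
          congr 1
          exact (Equiv.subRight (Fin.ofNat M 1)).sum_comp fun m => d m ^ 2
  have hγ : γ ^ 2 ≠ 1 := fun h => hγ1 ((pow_eq_one_iff_of_nonneg hγ0 two_ne_zero).mp h)
  have hsum0 : ∑ m, d m ^ 2 = 0 := by
    by_contra h
    exact hγ (mul_right_cancel₀ h (by rw [← hsum, one_mul]))
  have hd0 (m : Fin M) : v (m, i) = v (m - Fin.ofNat M 1, i) := by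
    have := (Finset.sum_eq_zero_iff_of_nonneg fun m _ => sq_nonneg (d m)).mp hsum0 m
      (Finset.mem_univ m)
    exact sub_eq_zero.mp (pow_eq_zero_iff two_ne_zero |>.mp this)
  have hk (k : ℕ) : v (Fin.ofNat M k, i) = v (0, i) := by
    induction k with
    | zero => simp
    | succ k ih =>
      rw [hd0, ← ih]
      congr 2
      rw [sub_eq_iff_eq_add]
      simp [Fin.ext_iff, Fin.val_add]
  simpa using hk m

end Blocks

lemma mul_transpose_add_mul_transpose_eq_one {n k l : Type*} [Fintype n] [Fintype k] [Fintype l]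
    [DecidableEq n] [DecidableEq k] [DecidableEq l]
    (hcard : Fintype.card k + Fintype.card l = Fintype.card n)
    {P : Matrix n k ℝ} {R : Matrix n l ℝ} (hP : Pᵀ * P = 1) (hR : Rᵀ * R = 1) (hRP : Rᵀ * P = 0) :
    P * Pᵀ + R * Rᵀ = 1 := by
  have hPR : Pᵀ * R = 0 := by simpa using congrArg Matrix.transpose hRP
  have e : k ⊕ l ≃ n := Fintype.equivOfCardEq (by simpa using hcard)
  have h : Matrix.fromRows Pᵀ Rᵀ * Matrix.fromCols P R = 1 := by
    rw [Matrix.fromRows_mul_fromCols, hP, hR, hRP, hPR, Matrix.fromBlocks_one]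
  rw [← Matrix.fromCols_mul_fromRows]
  exact (Matrix.mul_eq_one_comm_of_equiv e).mp h

lemma isUnit_compression {n k l : Type*} [Fintype n] [Fintype k] [Fintype l]
    [DecidableEq n] [DecidableEq l] {A : Matrix n n ℝ} {P : Matrix n k ℝ} {R : Matrix n l ℝ}
    (hres : P * Pᵀ + R * Rᵀ = 1) (hR : Rᵀ * R = 1) (hRP : Rᵀ * P = 0) (hPA : Pᵀ * A = 0)
    (hker : ∀ v, A *ᵥ v = 0 → ∃ y, P *ᵥ y = v) : IsUnit (Rᵀ * A * R) := by
  rw [← Matrix.mulVec_injective_iff_isUnit, ← Matrix.coe_mulVecLin, injective_iff_map_eq_zero]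
  intro z hz
  have hz' : (Rᵀ * A * R) *ᵥ z = 0 := hz
  have hA : A = R * (Rᵀ * A) := by
    conv_lhs => rw [← Matrix.one_mul A, ← hres, Matrix.add_mul, Matrix.mul_assoc, hPA,
      Matrix.mul_zero, zero_add, Matrix.mul_assoc]
  obtain ⟨y, hy⟩ := hker (R *ᵥ z) (by
    rw [hA, Matrix.mulVec_mulVec, Matrix.mul_assoc, ← Matrix.mulVec_mulVec, hz',
      Matrix.mulVec_zero])
  calc z = Rᵀ *ᵥ (R *ᵥ z) := by rw [Matrix.mulVec_mulVec, hR, Matrix.one_mulVec]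
    _ = 0 := by rw [← hy, Matrix.mulVec_mulVec, hRP, Matrix.zero_mulVec]

/-- First-order expansion of the stable solution `αΩ(α)⁻¹b*` around
the OLS solution: `A₂₂ = P₂ᵀAP₂` is invertible and, for all small `α > 0`, `Ω(α)` is
invertible and `‖αΩ(α)⁻¹b* − θ*_ols − αÊ‖ ≤ Cα²` with
`Ê = (P₁Σ̂⁻¹P₁ᵀB̂ − I_q) P₂A₂₂⁻¹P₂ᵀ (B̂θ*_ols − b*)`. -/
theorem stmt14 (M p : ℕ) (hM : 3 ≤ M) (hp : 1 ≤ p)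
    (γ : ℝ) (hγ0 : 0 ≤ γ) (hγ1 : γ ≠ 1)
    (Shat : Fin M → Matrix (Fin p) (Fin p) ℝ)
    (hpsd : ∀ m, (Shat m).PosSemidef)
    (Sbar : Matrix (Fin p) (Fin p) ℝ)
    (hSbar : Sbar = (M : ℝ)⁻¹ • ∑ m : Fin M, Shat m)
    (hSbarInv : IsUnit Sbar)
    (b : Fin M → (Fin p → ℝ))
    (bstar : Fin M × Fin p → ℝ) (hbstar : bstar = fun x => b x.1 x.2)
    (θols : Fin p → ℝ)
    (hθols : θols = Sbar⁻¹.mulVec ((M : ℝ)⁻¹ • ∑ m : Fin M, b m))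
    (θolsStar : Fin M × Fin p → ℝ) (hθolsStar : θolsStar = fun x => θols x.2)
    (P1 : Matrix (Fin M × Fin p) (Fin p) ℝ)
    (hP1 : P1 = Matrix.of fun x j =>
      (Real.sqrt M)⁻¹ * (1 : Matrix (Fin p) (Fin p) ℝ) x.2 j)
    (P2 : Matrix (Fin M × Fin p) (Fin (M * p - p)) ℝ)
    (hP2orth : P2ᵀ * P2 = 1) (hP2perp : P2ᵀ * P1 = 0) :
    IsUnit (P2ᵀ * blockA M p γ * P2) ∧
    ∃ α₀ > (0 : ℝ), ∃ c > (0 : ℝ), ∀ α : ℝ, 0 < α → α < α₀ →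
      IsUnit (blockA M p γ + α • blockB M p Shat) ∧
      eNorm
        (α • (blockA M p γ + α • blockB M p Shat)⁻¹.mulVec bstar - θolsStar -
          α • (((P1 * Sbar⁻¹ * P1ᵀ * blockB M p Shat - 1) *
              (P2 * (P2ᵀ * blockA M p γ * P2)⁻¹ * P2ᵀ)).mulVec
            ((blockB M p Shat).mulVec θolsStar - bstar)))
        ≤ c * α ^ 2 := by
  have : NeZero M := ⟨by omega⟩
  set A := blockA M p γ with hA
  set B := blockB M p Shat with hB
  have hM0 : (M : ℝ) ≠ 0 := by exact_mod_cast NeZero.ne M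
  have hsM0 : √(M : ℝ) ≠ 0 := by positivity
  have hsM : (√(M : ℝ))⁻¹ * (√(M : ℝ))⁻¹ = (M : ℝ)⁻¹ := by
    rw [← mul_inv, Real.mul_self_sqrt (by positivity)]
  have hP1v (y : Fin p → ℝ) : P1 *ᵥ y = fun x => ((√(M : ℝ))⁻¹ • y) x.2 := by
    ext x
    simp [hP1, Matrix.mulVec, dotProduct, Matrix.one_apply]
  have hP1t (v : Fin M × Fin p → ℝ) : P1ᵀ *ᵥ v = (√(M : ℝ))⁻¹ • fun i => ∑ m, v (m, i) := by
    ext i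
    simp [hP1, Matrix.mulVec, dotProduct, Matrix.one_apply, Fintype.sum_prod_type, Finset.mul_sum]
  have hAP1 : A * P1 = 0 := by
    refine Matrix.ext_of_mulVec_single fun j => ?_
    rw [← Matrix.mulVec_mulVec, hP1v]
    ext ⟨m, i⟩
    rw [blockA_mulVec hM, Matrix.zero_mulVec]
    simp only [Pi.zero_apply]
    ring
  have hP1A : P1ᵀ * A = 0 := by
    refine Matrix.ext_of_mulVec_single fun j => ?_
    rw [← Matrix.mulVec_mulVec, hP1t, Matrix.zero_mulVec]
    ext i
    simp only [Pi.smul_apply, hA, sum_blockA_mulVec hM, smul_zero, Pi.zero_apply]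
  have hP1P1 : P1ᵀ * P1 = 1 := by
    refine Matrix.ext_of_mulVec_single fun j => ?_
    rw [← Matrix.mulVec_mulVec, hP1t, hP1v, Matrix.one_mulVec]
    ext i
    simp only [Pi.smul_apply, Finset.sum_const, Finset.card_univ, Fintype.card_fin, smul_eq_mul,
      nsmul_eq_mul]
    rw [mul_left_comm, ← mul_assoc (_⁻¹) (_⁻¹), hsM, mul_inv_cancel_left₀ hM0]
  have hP1B (θ : Fin p → ℝ) :
      P1ᵀ *ᵥ (B *ᵥ fun x => θ x.2) = (√(M : ℝ))⁻¹ • ((∑ m, Shat m) *ᵥ θ) := by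
    rw [hB, blockB_mulVec_const hM, hP1t]
    ext i
    simp [Matrix.sum_mulVec]
  have hP1BP1 : P1ᵀ * B * P1 = Sbar := by
    refine Matrix.ext_of_mulVec_single fun j => ?_
    rw [← Matrix.mulVec_mulVec, ← Matrix.mulVec_mulVec, hP1v, hP1B, Matrix.mulVec_smul,
      smul_smul, hsM, hSbar, Matrix.smul_mulVec]
  have hres : P1 * P1ᵀ + P2 * P2ᵀ = 1 := by
    refine mul_transpose_add_mul_transpose_eq_one ?_ hP1P1 hP2orth hP2perp
    have : p ≤ M * p := Nat.le_mul_of_pos_left p (by omega)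
    simp only [Fintype.card_fin, Fintype.card_prod]
    omega
  have hA22 : IsUnit (P2ᵀ * A * P2) := by
    refine isUnit_compression hres hP2orth hP2perp hP1A fun v hv => ?_
    refine ⟨√(M : ℝ) • fun i => v (0, i), ?_⟩
    rw [hP1v]
    ext ⟨m, i⟩
    simp [hsM0, eq_const_of_blockA_mulVec_eq_zero hM hγ0 hγ1 hv m i]
  refine ⟨hA22, ?_⟩
  set S := P1 * Sbar⁻¹ * P1ᵀ with hS
  set T := (S * B - 1) * (P2 * (P2ᵀ * A * P2)⁻¹ * P2ᵀ) with hT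
  have hSb : S *ᵥ bstar = θolsStar := by
    rw [hS, ← Matrix.mulVec_mulVec, ← Matrix.mulVec_mulVec, hP1t, hP1v, Matrix.mulVec_smul,
      smul_smul, hsM, hθolsStar, hθols, Matrix.mulVec_smul]
    have : (fun i => ∑ m, bstar (m, i)) = ∑ m, b m := by
      ext i
      simp [hbstar]
    rw [this]
  have hP1BS : P1ᵀ * (B * S) = P1ᵀ := by
    rw [hS, ← Matrix.mul_assoc, ← Matrix.mul_assoc, ← Matrix.mul_assoc, hP1BP1,
      Matrix.mul_nonsing_inv _ ((Matrix.isUnit_iff_isUnit_det _).mp hSbarInv), Matrix.one_mul]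
  have hQ {X : Matrix (Fin M × Fin p) (Fin M × Fin p) ℝ} (hX : P1ᵀ * X = 0) :
      P2 * P2ᵀ * X = X := by
    rw [eq_sub_iff_add_eq'.mpr hres, sub_mul, one_mul, Matrix.mul_assoc, hX, Matrix.mul_zero,
      sub_zero]
  have hAS : A * S = 0 := by
    rw [hS, ← Matrix.mul_assoc, ← Matrix.mul_assoc, hAP1, Matrix.zero_mul, Matrix.zero_mul]
  have hAT : A * T = -(P2 * P2ᵀ) := by
    have hinv := Matrix.mul_nonsing_inv _ ((Matrix.isUnit_iff_isUnit_det _).mp hA22)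
    have hAP2 : A * P2 = P2 * (P2ᵀ * A * P2) := by
      conv_lhs => rw [← hQ hP1A]
      simp only [Matrix.mul_assoc]
    rw [hT, ← mul_assoc, mul_sub, ← mul_assoc, hAS, zero_mul, zero_sub, mul_one, neg_mul,
      ← Matrix.mul_assoc, ← Matrix.mul_assoc, hAP2, Matrix.mul_assoc P2, hinv, Matrix.mul_one]
  have hQT : P2 * P2ᵀ * (B * T) = B * T := by
    refine hQ ?_
    have h0 : P1ᵀ * (B * (S * B - 1)) = 0 := by
      rw [mul_sub, mul_one, ← mul_assoc, Matrix.mul_sub, ← Matrix.mul_assoc, hP1BS, sub_self]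
    rw [hT, ← mul_assoc, ← Matrix.mul_assoc, h0, Matrix.zero_mul]
  have hQS : P2 * P2ᵀ * (1 - B * S) = 1 - B * S :=
    hQ (by rw [Matrix.mul_sub, Matrix.mul_one, hP1BS, sub_self])
  obtain ⟨α₀, hα₀, c, hc, h⟩ :=
    exists_isUnit_det_and_eNorm_le (B * T) T (B * T) (B *ᵥ (S *ᵥ bstar) - bstar)
  refine ⟨α₀, hα₀, c, hc, fun α hα hαα₀ => ?_⟩
  obtain ⟨hdet, hle⟩ := h α hα hαα₀
  refine ⟨IsUnit.of_mul_eq_one _ (add_smul_mul_eq_one hα.ne' hAS hAT hQT hQS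
    (Matrix.mul_nonsing_inv _ hdet)), ?_⟩
  rw [← hSb, smul_inv_add_smul_mulVec hα.ne' hAS hAT hQT hQS hdet, eNorm_sq_smul, mul_comm c]
  gcongr
end

section
/- Let M ≥ 3, p ≥ 1, q = Mp, and γ ∈ ℝ. Let A ∈ ℝ^{q×q} be the M×M block matrix (p×p blocks) whose (m,m) block is I_p, whose (m, m−1 mod M) block is −(1+γ)I_p, whose (m, m−2 mod M) block is γI_p, and whose remaining blocks are zero. Let P_1 = M^{-1/2} 1_M ⊗ I_p ∈ ℝ^{q×p} and let P_2 ∈ ℝ^{q×(q−p)} be any matrix with P_2ᵀP_2 = I_{q−p} and P_2ᵀP_1 = 0. Then ‖P_2ᵀAP_2‖_F² = ((1+γ)² + γ² + 1)q, i.e., the Frobenius norm of P_2ᵀAP_2 equals the Frobenius norm of A. -/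
set_option autoImplicit false

open Matrix

/-- The scalar circulant pattern of `blockA`. -/
def circulantCoeff (k : ℕ) (γ : ℝ) (m n : Fin (k + 3)) : ℝ :=
  (if n = m then 1 else 0) - (1 + γ) * (if n = m - 1 then 1 else 0)
    + γ * (if n = m - 2 then 1 else 0)

lemma sub_one_ne_self (k : ℕ) (m : Fin (k + 3)) : m - 1 ≠ m := by
  simp [sub_eq_self]

lemma two_ne_zero_fin (k : ℕ) : (2 : Fin (k + 3)) ≠ 0 := by
  simp [Fin.ext_iff, Nat.mod_eq_of_lt]

lemma sub_two_ne_self (k : ℕ) (m : Fin (k + 3)) : m - 2 ≠ m := by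
  simpa [sub_eq_self] using two_ne_zero_fin k

lemma sub_two_ne_sub_one (k : ℕ) (m : Fin (k + 3)) : m - 2 ≠ m - 1 := by
  intro h
  have h' : (2 : Fin (k + 3)) = 1 := sub_right_injective h
  simp [Fin.ext_iff, Nat.mod_eq_of_lt] at h'

lemma blockA_apply (k p : ℕ) (γ : ℝ) (x y : Fin (k + 3) × Fin p) :
    blockA (k + 3) p γ x y =
      circulantCoeff k γ x.1 y.1 * (1 : Matrix (Fin p) (Fin p) ℝ) x.2 y.2 := by
  obtain ⟨m, i⟩ := x
  obtain ⟨n, j⟩ := y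
  have e0 : (n : ℕ) = (m : ℕ) ↔ n = m := Fin.ext_iff.symm
  have e1 : (n : ℕ) = ((m : ℕ) + (k + 3 - 1)) % (k + 3) ↔ n = m - 1 := by
    rw [Fin.ext_iff, Fin.val_sub]
    simp [add_comm]
  have e2 : (n : ℕ) = ((m : ℕ) + (k + 3 - 2)) % (k + 3) ↔ n = m - 2 := by
    rw [Fin.ext_iff, Fin.val_sub]
    simp [add_comm, Nat.mod_eq_of_lt]
  simp only [blockA, Matrix.of_apply, circulantCoeff, e0, e1, e2]
  have h1 := sub_one_ne_self k m
  have h2 := sub_two_ne_self k m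
  have h3 := sub_two_ne_sub_one k m
  by_cases a : n = m
  · subst a
    simp [h1.symm, h2.symm]
  by_cases b : n = m - 1
  · subst b
    simp [h1, h3.symm]
    ring
  by_cases c : n = m - 2
  · subst c
    simp [h2, h3]
  simp [a, b, c]

lemma sum_circulantCoeff_row (k : ℕ) (γ : ℝ) (m : Fin (k + 3)) :
    ∑ n, circulantCoeff k γ m n = 0 := by
  simp [circulantCoeff, Finset.sum_add_distrib, Finset.sum_sub_distrib]

lemma sum_circulantCoeff_col (k : ℕ) (γ : ℝ) (n : Fin (k + 3)) :
    ∑ m, circulantCoeff k γ m n = 0 := by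
  simp [circulantCoeff, Finset.sum_add_distrib, Finset.sum_sub_distrib, eq_sub_iff_add_eq]

lemma sum_circulantCoeff_sq (k : ℕ) (γ : ℝ) (m : Fin (k + 3)) :
    ∑ n, circulantCoeff k γ m n ^ 2 = (1 + γ) ^ 2 + γ ^ 2 + 1 := by
  have h1 := sub_one_ne_self k m
  have h2 := sub_two_ne_self k m
  have h3 := sub_two_ne_sub_one k m
  have h (n : Fin (k + 3)) : circulantCoeff k γ m n ^ 2 =
      (if n = m then 1 else 0) + (1 + γ) ^ 2 * (if n = m - 1 then 1 else 0)
        + γ ^ 2 * (if n = m - 2 then 1 else 0) := by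
    unfold circulantCoeff
    by_cases a : n = m
    · subst a
      simp [h1.symm, h2.symm]
    by_cases b : n = m - 1
    · subst b
      simp [h1, h3.symm]
      ring
    by_cases c : n = m - 2
    · subst c
      simp [h2, h3]
    simp [a, b, c]
  simp only [h, Finset.sum_add_distrib, ← Finset.mul_sum, Finset.sum_ite_eq', Finset.mem_univ,
    if_true]
  ring

lemma trace_blockA_transpose_mul_self (k p : ℕ) (γ : ℝ) :
    Matrix.trace ((blockA (k + 3) p γ)ᵀ * blockA (k + 3) p γ) =
      ((1 + γ) ^ 2 + γ ^ 2 + 1) * ((k + 3) * p : ℕ) := by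
  have h (x : Fin (k + 3) × Fin p) :
      ∑ y, blockA (k + 3) p γ x y * blockA (k + 3) p γ x y = (1 + γ) ^ 2 + γ ^ 2 + 1 := by
    rw [← sum_circulantCoeff_sq k γ x.1, Fintype.sum_prod_type]
    refine Finset.sum_congr rfl fun n _ => ?_
    simp [blockA_apply, Matrix.one_apply, sq]
  rw [Matrix.trace]
  simp only [Matrix.diag_apply, Matrix.mul_apply, Matrix.transpose_apply]
  rw [Finset.sum_comm]
  simp only [h]
  simp [-mul_eq_mul_right_iff]
  ring

lemma mul_transpose_self_add_eq_one {ι κ μ : Type*} [Fintype ι] [Fintype κ] [Fintype μ]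
    [DecidableEq ι] [DecidableEq κ] [DecidableEq μ] (U : Matrix ι κ ℝ) (V : Matrix ι μ ℝ)
    (hcard : Fintype.card ι = Fintype.card κ + Fintype.card μ)
    (hU : Uᵀ * U = 1) (hV : Vᵀ * V = 1) (hUV : Uᵀ * V = 0) :
    U * Uᵀ + V * Vᵀ = 1 := by
  have hVU : Vᵀ * U = 0 := by
    rw [← Matrix.transpose_transpose U, ← Matrix.transpose_mul, hUV, Matrix.transpose_zero]
  have h : Matrix.fromRows Uᵀ Vᵀ * Matrix.fromCols U V = 1 := by
    rw [Matrix.fromRows_mul_fromCols, hU, hV, hUV, hVU, Matrix.fromBlocks_one]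
  rw [← Matrix.fromCols_mul_fromRows]
  exact (Matrix.mul_eq_one_comm_of_card_eq _ _ _ (by simpa using hcard.symm)).mp h

/-- Compressing `A` to the range of `U` keeps its Frobenius norm when `A` and `Aᵀ` vanish on the
orthogonal complement of that range. -/
lemma trace_compression {ι κ μ : Type*} [Fintype ι] [Fintype κ] [Fintype μ] [DecidableEq ι]
    (A : Matrix ι ι ℝ) (U : Matrix ι κ ℝ) (V : Matrix ι μ ℝ)
    (h : U * Uᵀ + V * Vᵀ = 1) (hA : A * V = 0) (hA' : Aᵀ * V = 0) :
    Matrix.trace ((Uᵀ * A * U)ᵀ * (Uᵀ * A * U)) = Matrix.trace (Aᵀ * A) := by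
  have e : U * Uᵀ = 1 - V * Vᵀ := eq_sub_of_add_eq h
  have r : A * (U * Uᵀ) = A := by
    rw [e, Matrix.mul_sub, ← Matrix.mul_assoc, hA]; simp
  have r' : Aᵀ * (U * Uᵀ) = Aᵀ := by
    rw [e, Matrix.mul_sub, ← Matrix.mul_assoc, hA']; simp
  calc Matrix.trace ((Uᵀ * A * U)ᵀ * (Uᵀ * A * U))
      = Matrix.trace (Uᵀ * (Aᵀ * (U * Uᵀ) * A * U)) := by
        simp only [Matrix.transpose_mul, Matrix.transpose_transpose, Matrix.mul_assoc]
    _ = Matrix.trace (Aᵀ * (U * Uᵀ) * (A * (U * Uᵀ))) := by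
        rw [Matrix.trace_mul_comm]
        simp only [Matrix.mul_assoc]
    _ = Matrix.trace (Aᵀ * A) := by rw [r, r']

/-- For any `P₂` with orthonormal columns orthogonal to
`P₁ = M^{-1/2} 1_M ⊗ I_p`, the squared Frobenius norm of `P₂ᵀAP₂` equals
`((1+γ)² + γ² + 1) q` with `q = Mp`, i.e. it equals the squared Frobenius norm
of `A` itself. -/
theorem stmt15 (M p : ℕ) (hM : 3 ≤ M) (hp : 1 ≤ p) (γ : ℝ)
    (P1 : Matrix (Fin M × Fin p) (Fin p) ℝ)
    (hP1 : P1 = Matrix.of fun x j =>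
      (Real.sqrt M)⁻¹ * (1 : Matrix (Fin p) (Fin p) ℝ) x.2 j)
    (P2 : Matrix (Fin M × Fin p) (Fin (M * p - p)) ℝ)
    (hP2orth : P2ᵀ * P2 = 1) (hP2perp : P2ᵀ * P1 = 0) :
    Matrix.trace ((P2ᵀ * blockA M p γ * P2)ᵀ * (P2ᵀ * blockA M p γ * P2))
      = ((1 + γ) ^ 2 + γ ^ 2 + 1) * (M * p : ℕ) ∧
    Matrix.trace ((P2ᵀ * blockA M p γ * P2)ᵀ * (P2ᵀ * blockA M p γ * P2))
      = Matrix.trace ((blockA M p γ)ᵀ * blockA M p γ) := by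
  obtain ⟨k, rfl⟩ : ∃ k, M = k + 3 := ⟨M - 3, by omega⟩
  have hV : P1ᵀ * P1 = 1 := by
    have hs : (Real.sqrt ((k + 3 : ℕ) : ℝ))⁻¹ * (Real.sqrt ((k + 3 : ℕ) : ℝ))⁻¹
        = ((k + 3 : ℕ) : ℝ)⁻¹ := by
      rw [← mul_inv, Real.mul_self_sqrt (Nat.cast_nonneg _)]
    have hk : ((k + 3 : ℕ) : ℝ) ≠ 0 := by positivity
    ext i j
    simp only [hP1, Matrix.mul_apply, Matrix.transpose_apply, Matrix.of_apply,
      mul_mul_mul_comm _ _ (Real.sqrt _)⁻¹, hs]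
    rw [Fintype.sum_prod_type]
    push_cast at hk ⊢
    rcases eq_or_ne i j with rfl | hij
    · simp [Matrix.one_apply, hk]
    · simp [Matrix.one_apply, hij, hij.symm]
  have hA : blockA (k + 3) p γ * P1 = 0 := by
    ext x j
    simp only [hP1, Matrix.mul_apply, Matrix.of_apply, blockA_apply]
    rw [Fintype.sum_prod_type]
    simp [Matrix.one_apply, ← Finset.sum_mul, sum_circulantCoeff_row]
  have hA' : (blockA (k + 3) p γ)ᵀ * P1 = 0 := by
    ext x j
    simp only [hP1, Matrix.mul_apply, Matrix.transpose_apply, Matrix.of_apply, blockA_apply]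
    rw [Fintype.sum_prod_type]
    simp [Matrix.one_apply, ← Finset.sum_mul, sum_circulantCoeff_col]
  have hcard : Fintype.card (Fin (k + 3) × Fin p)
      = Fintype.card (Fin ((k + 3) * p - p)) + Fintype.card (Fin p) := by
    have : p ≤ (k + 3) * p := Nat.le_mul_of_pos_left p (by omega)
    simp only [Fintype.card_prod, Fintype.card_fin]
    omega
  have key := trace_compression _ P2 P1
    (mul_transpose_self_add_eq_one P2 P1 hcard hP2orth hV hP2perp) hA hA'
  exact ⟨key.trans (trace_blockA_transpose_mul_self k p γ), key⟩
end

section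
/- Let M ≥ 3 and γ ≥ 0 with γ ≠ 1. Let Ã ∈ ℝ^{M×M} be the circulant matrix with entries Ã_{mm} = 1, Ã_{m, m−1 mod M} = −(1+γ), Ã_{m, m−2 mod M} = γ, and all other entries zero. Then the null space of à is exactly the span of the all-ones vector 1_M; in particular rank(Ã) = M − 1. -/
set_option autoImplicit false

open Matrix

/-- The `M × M` circulant matrix with `1` on the diagonal, `-(1+γ)` in position
`(m, m-1 mod M)` and `γ` in position `(m, m-2 mod M)`. -/
def circA (M : ℕ) (γ : ℝ) : Matrix (Fin M) (Fin M) ℝ :=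
  Matrix.of fun m m' =>
    if (m' : ℕ) = (m : ℕ) then 1
    else if (m' : ℕ) = ((m : ℕ) + (M - 1)) % M then -(1 + γ)
    else if (m' : ℕ) = ((m : ℕ) + (M - 2)) % M then γ
    else 0

theorem circA_mulVec_apply (n : ℕ) (γ : ℝ) (v : Fin (n + 3) → ℝ) (m : Fin (n + 3)) :
    (circA (n + 3) γ).mulVec v m = v m - (1 + γ) * v (m - 1) + γ * v (m - 2) := by
  have hentry (j : Fin (n + 3)) : circA (n + 3) γ m j =
      (if j = m then 1 else 0) + (if j = m - 1 then -(1 + γ) else 0)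
        + (if j = m - 2 then γ else 0) := by
    have e1 : (j : ℕ) = ((m : ℕ) + (n + 3 - 1)) % (n + 3) ↔ j = m - 1 := by
      rw [Fin.ext_iff, Fin.sub_def]
      simp [Nat.add_comm]
    have e2 : (j : ℕ) = ((m : ℕ) + (n + 3 - 2)) % (n + 3) ↔ j = m - 2 := by
      rw [Fin.ext_iff, Fin.sub_def]
      simp [Nat.add_comm, Nat.mod_eq_of_lt]
    have h10 : (1 : Fin (n + 3)) ≠ 0 := by simp
    have h20 : (2 : Fin (n + 3)) ≠ 0 := by
      simp [Fin.ext_iff, Nat.mod_eq_of_lt]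
    have h12 : (1 : Fin (n + 3)) ≠ 2 := by
      simp [Fin.ext_iff, Nat.mod_eq_of_lt]
    have hm1 : m ≠ m - 1 := fun h => h10 (sub_eq_self.1 h.symm)
    have hm2 : m ≠ m - 2 := fun h => h20 (sub_eq_self.1 h.symm)
    have hm12 : m - 1 ≠ m - 2 := fun h => h12 (sub_right_injective h)
    simp only [circA, Matrix.of_apply, e1, e2, ← Fin.ext_iff]
    by_cases hj : j = m
    · subst hj; simp [hm1, hm2]
    by_cases hj1 : j = m - 1
    · subst hj1; simp [hj, hm12]
    simp [hj, hj1]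
  simp only [Matrix.mulVec, dotProduct, hentry, add_mul, Finset.sum_add_distrib, ite_mul,
    zero_mul, one_mul, Finset.sum_ite_eq', Finset.mem_univ, if_true]
  ring

open scoped Fin.CommRing in
theorem eq_const_of_forall_eq_sub_one (n : ℕ) (v : Fin (n + 3) → ℝ)
    (h : ∀ m, v m = v (m - 1)) : v = fun _ => v 0 := by
  have hk (k : ℕ) : v (k : Fin (n + 3)) = v 0 := by
    induction k with
    | zero => simp
    | succ k ih => rw [h, Nat.cast_succ, add_sub_cancel_right, ih]
  funext m
  simpa using hk m

open scoped Fin.CommRing in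
theorem eq_zero_of_forall_eq_mul_sub_one (n : ℕ) (γ : ℝ) (hγ0 : 0 ≤ γ) (hγ1 : γ ≠ 1)
    (w : Fin (n + 3) → ℝ) (h : ∀ m, w m = γ * w (m - 1)) (m : Fin (n + 3)) : w m = 0 := by
  have hk (k : ℕ) : w (m + k) = γ ^ k * w m := by
    induction k with
    | zero => simp
    | succ k ih =>
      rw [h, Nat.cast_succ, ← add_assoc, add_sub_cancel_right, ih]
      ring
  have hM := hk (n + 3)
  rw [Fin.natCast_self, add_zero] at hM
  have hpow : γ ^ (n + 3) ≠ 1 := fun h => hγ1 ((pow_eq_one_iff_of_nonneg hγ0 (by omega)).1 h)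
  have hprod : (γ ^ (n + 3) - 1) * w m = 0 := by linarith
  exact (mul_eq_zero.1 hprod).resolve_left (sub_ne_zero.2 hpow)

theorem circA_mulVec_eq_zero_iff (n : ℕ) (γ : ℝ) (hγ0 : 0 ≤ γ) (hγ1 : γ ≠ 1)
    (v : Fin (n + 3) → ℝ) :
    (circA (n + 3) γ).mulVec v = 0 ↔ ∃ c : ℝ, v = fun _ => c := by
  constructor
  · intro hv
    refine ⟨v 0, eq_const_of_forall_eq_sub_one n v fun m => sub_eq_zero.1 ?_⟩
    refine eq_zero_of_forall_eq_mul_sub_one n γ hγ0 hγ1 (fun m => v m - v (m - 1)) (fun m => ?_) m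
    have hm := congrFun hv m
    rw [circA_mulVec_apply, Pi.zero_apply] at hm
    have h2 : m - 1 - 1 = m - 2 := by
      rw [sub_sub]
      exact congrArg _ (Fin.ext (by simp [Fin.val_add, Nat.mod_eq_of_lt]))
    simp only [h2]
    linarith
  · rintro ⟨c, rfl⟩
    funext m
    rw [circA_mulVec_apply, Pi.zero_apply]
    ring

theorem circA_rank (n : ℕ) (γ : ℝ) (hγ0 : 0 ≤ γ) (hγ1 : γ ≠ 1) :
    (circA (n + 3) γ).rank = n + 2 := by
  have hker : LinearMap.ker (circA (n + 3) γ).mulVecLin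
      = Submodule.span ℝ {(fun _ => 1 : Fin (n + 3) → ℝ)} := by
    ext v
    rw [LinearMap.mem_ker, Matrix.mulVecLin_apply, circA_mulVec_eq_zero_iff n γ hγ0 hγ1,
      Submodule.mem_span_singleton]
    refine exists_congr fun c => ?_
    simp [funext_iff, eq_comm]
  have hone : (fun _ => 1 : Fin (n + 3) → ℝ) ≠ 0 := fun h => one_ne_zero (congrFun h 0)
  have hdim := (circA (n + 3) γ).mulVecLin.finrank_range_add_finrank_ker
  rw [hker, finrank_span_singleton hone, Module.finrank_fin_fun] at hdim
  rw [Matrix.rank]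
  omega

/-- For `M ≥ 3` and `γ ≥ 0` with `γ ≠ 1`, the null space of the
circulant matrix `Ã` is exactly the span of the all-ones vector; in particular
`rank(Ã) = M − 1`. -/
theorem stmt16 (M : ℕ) (hM : 3 ≤ M) (γ : ℝ) (hγ0 : 0 ≤ γ) (hγ1 : γ ≠ 1) :
    (∀ v : Fin M → ℝ, (circA M γ).mulVec v = 0 ↔ ∃ c : ℝ, v = fun _ => c) ∧
    (circA M γ).rank = M - 1 := by
  obtain ⟨n, rfl⟩ := Nat.exists_eq_add_of_le' hM
  exact ⟨circA_mulVec_eq_zero_iff n γ hγ0 hγ1, circA_rank n γ hγ0 hγ1⟩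
end

section
/- Let M ≥ 2. Let à ∈ ℝ^{M×M} have entries Ã_{mm} = 1, Ã_{m, m−1 mod M} = −1, and all other entries zero. Let a ∈ ℝ^M have entries a_0 = (M−1)/(2M) and a_m = (2m − M − 1)/(2M) for 1 ≤ m ≤ M−1, and let Q ∈ ℝ^{M×M} be the circulant matrix with entries Q_{ij} = a_{(j−i) mod M}. Then ∑_{m=0}^{M−1} a_m = 0, and QÃ = ÃQ = I_M − M^{-1} 1_M 1_Mᵀ. -/
set_option autoImplicit false

open Matrix

/-- The generating entries of the circulant matrix `Q`:
`a_0 = (M−1)/(2M)` and `a_m = (2m − M − 1)/(2M)` for `1 ≤ m ≤ M−1`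
(read cyclically, via reduction mod `M`). -/
noncomputable def aVec (M : ℕ) : ℕ → ℝ := fun m =>
  if m % M = 0 then ((M : ℝ) - 1) / (2 * M)
  else (2 * ((m % M : ℕ) : ℝ) - M - 1) / (2 * M)

/-- The circulant matrix `Q` with entries `Q_{ij} = a_{(j−i) mod M}`. -/
noncomputable def circQ (M : ℕ) : Matrix (Fin M) (Fin M) ℝ :=
  Matrix.of fun i j => aVec M ((j : ℕ) + M - (i : ℕ))

/-- The `M × M` circulant matrix `Ã` with `1` on the diagonal, `-1` in position
`(m, m-1 mod M)`, and `0` elsewhere. -/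
def circA0 (M : ℕ) : Matrix (Fin M) (Fin M) ℝ :=
  Matrix.of fun m m' =>
    if (m' : ℕ) = (m : ℕ) then 1
    else if (m' : ℕ) = ((m : ℕ) + (M - 1)) % M then -1
    else 0

theorem aVec_congr {M k l : ℕ} (h : k % M = l % M) : aVec M k = aVec M l := by
  simp only [aVec, h]

theorem aVec_sub_aVec_succ {M : ℕ} (hM : 2 ≤ M) (k : ℕ) :
    aVec M k - aVec M (k + 1) = (if k % M = 0 then 1 else 0) - (M : ℝ)⁻¹ := by
  have hM0 : (M : ℝ) ≠ 0 := by positivity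
  have hlt := Nat.mod_lt k (show 0 < M by omega)
  have hmod : (k + 1) % M = if k % M + 1 = M then 0 else k % M + 1 := by
    rw [Nat.add_mod, Nat.mod_eq_of_lt (show 1 < M by omega)]
    split_ifs with h
    · rw [h, Nat.mod_self]
    · exact Nat.mod_eq_of_lt (by omega)
  unfold aVec
  rw [hmod]
  generalize k % M = r at *
  by_cases hr : r + 1 = M
  · have hcast : (M : ℝ) = r + 1 := by rw [← hr]; push_cast; rfl
    have hr0 : r ≠ 0 := by omega
    simp only [hr, hr0, if_true, if_false]
    field_simp
    rw [hcast]
    ring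
  · by_cases hr0 : r = 0
    · subst hr0
      simp only [hr, if_true, if_false, zero_add, one_ne_zero]
      field_simp
      push_cast
      ring
    · simp only [hr, hr0, if_false, Nat.succ_ne_zero]
      field_simp
      push_cast
      ring

theorem sum_aVec {M : ℕ} (hM : 0 < M) : ∑ m : Fin M, aVec M (m : ℕ) = 0 := by
  obtain ⟨n, rfl⟩ := Nat.exists_eq_succ_of_ne_zero hM.ne'
  have hn : (n : ℝ) + 1 ≠ 0 := by positivity
  have hsum : ∀ (c : ℝ) (k : ℕ),
      ∑ i ∈ Finset.range k, (2 * ((i : ℝ) + 1) - c) = k * (k + 1) - k * c := by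
    intro c k
    induction k with
    | zero => simp
    | succ k ih => rw [Finset.sum_range_succ, ih]; push_cast; ring
  have hpos : ∀ i ∈ Finset.range n,
      aVec (n + 1) (i + 1) = (2 * ((i : ℝ) + 1) - (n + 2)) / (2 * (n + 1)) := by
    intro i hi
    have hmod : (i + 1) % (n + 1) = i + 1 :=
      Nat.mod_eq_of_lt (by simpa using Finset.mem_range.mp hi)
    simp only [aVec, hmod, Nat.succ_ne_zero, if_false]
    push_cast
    ring
  rw [Fin.sum_univ_eq_sum_range (aVec (n + 1)) (n + 1), Finset.sum_range_succ',
    Finset.sum_congr rfl hpos, ← Finset.sum_div, hsum]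
  simp only [aVec, Nat.zero_mod, if_true]
  push_cast
  field_simp
  ring

theorem circQ_congr {M k : ℕ} {i j : Fin M} (h : (k + i) % M = j % M) :
    circQ M i j = aVec M k := by
  refine aVec_congr ?_
  have hi := i.isLt
  refine Nat.ModEq.add_right_cancel' (i : ℕ) ?_
  change ((j : ℕ) + M - i + i) % M = (k + i) % M
  rw [h, Nat.sub_add_cancel (by omega), Nat.add_mod_right]

/-- The cyclic predecessor of an index. -/
def cyclicPred {M : ℕ} (m : Fin M) : Fin M :=
  ⟨((m : ℕ) + (M - 1)) % M, Nat.mod_lt _ m.pos⟩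

/-- The cyclic successor of an index. -/
def cyclicSucc {M : ℕ} (m : Fin M) : Fin M :=
  ⟨((m : ℕ) + 1) % M, Nat.mod_lt _ m.pos⟩

theorem cyclicSucc_cyclicPred {M : ℕ} (m : Fin M) : cyclicSucc (cyclicPred m) = m := by
  have hm := m.isLt
  ext
  simp only [cyclicSucc, cyclicPred, Nat.mod_add_mod]
  rw [show (m : ℕ) + (M - 1) + 1 = m + M by omega, Nat.add_mod_right, Nat.mod_eq_of_lt hm]

theorem cyclicPred_cyclicSucc {M : ℕ} (m : Fin M) : cyclicPred (cyclicSucc m) = m := by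
  have hm := m.isLt
  ext
  simp only [cyclicSucc, cyclicPred, Nat.mod_add_mod]
  rw [show (m : ℕ) + 1 + (M - 1) = m + M by omega, Nat.add_mod_right, Nat.mod_eq_of_lt hm]

theorem eq_cyclicPred_iff {M : ℕ} {m m' : Fin M} : m' = cyclicPred m ↔ m = cyclicSucc m' :=
  ⟨fun h => by rw [h, cyclicSucc_cyclicPred], fun h => by rw [h, cyclicPred_cyclicSucc]⟩

theorem cyclicPred_ne {M : ℕ} (hM : 2 ≤ M) (m : Fin M) : cyclicPred m ≠ m := by
  intro h
  have hv : ((m : ℕ) + (M - 1)) % M = m := congrArg Fin.val h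
  have hm := m.isLt
  rcases Nat.eq_zero_or_pos (m : ℕ) with h0 | h0
  · rw [h0, Nat.mod_eq_of_lt (by omega)] at hv
    omega
  · rw [show (m : ℕ) + (M - 1) = (m - 1) + M by omega, Nat.add_mod_right,
      Nat.mod_eq_of_lt (by omega)] at hv
    omega

theorem circA0_apply {M : ℕ} (hM : 2 ≤ M) (m m' : Fin M) :
    circA0 M m m' = (if m' = m then 1 else 0) - (if m' = cyclicPred m then 1 else 0) := by
  have hp := cyclicPred_ne hM m
  have h1 : (m' : ℕ) = m ↔ m' = m := Fin.ext_iff.symm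
  have h2 : (m' : ℕ) = ((m : ℕ) + (M - 1)) % M ↔ m' = cyclicPred m := by
    rw [Fin.ext_iff, cyclicPred]
  simp only [circA0, Matrix.of_apply, h1, h2]
  by_cases h : m' = m
  · subst h
    simp [hp.symm]
  · simp only [h, if_false]
    split_ifs <;> simp

theorem mul_circA0_apply {M : ℕ} (hM : 2 ≤ M) (B : Matrix (Fin M) (Fin M) ℝ) (i j : Fin M) :
    (B * circA0 M) i j = B i j - B i (cyclicSucc j) := by
  simp [Matrix.mul_apply, circA0_apply hM, eq_cyclicPred_iff, mul_sub]

theorem circA0_mul_apply {M : ℕ} (hM : 2 ≤ M) (B : Matrix (Fin M) (Fin M) ℝ) (i j : Fin M) :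
    (circA0 M * B) i j = B i j - B (cyclicPred i) j := by
  simp [Matrix.mul_apply, circA0_apply hM, sub_mul]

theorem circQ_cyclicSucc {M : ℕ} (i j : Fin M) :
    circQ M i (cyclicSucc j) = aVec M ((j : ℕ) + M - i + 1) := by
  have hi := i.isLt
  refine circQ_congr ?_
  simp only [cyclicSucc, Nat.mod_mod]
  rw [show (j : ℕ) + M - i + 1 + i = j + 1 + M by omega, Nat.add_mod_right]

theorem circQ_cyclicPred {M : ℕ} (i j : Fin M) :
    circQ M (cyclicPred i) j = aVec M ((j : ℕ) + M - i + 1) := by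
  have hi := i.isLt
  refine circQ_congr ?_
  simp only [cyclicPred, Nat.add_mod_mod]
  rw [show (j : ℕ) + M - i + 1 + (i + (M - 1)) = j + M + M by omega, Nat.add_mod_right,
    Nat.add_mod_right]

theorem aVec_sub_aVec_succ_eq_projection {M : ℕ} (hM : 2 ≤ M) (i j : Fin M) :
    aVec M ((j : ℕ) + M - i) - aVec M ((j : ℕ) + M - i + 1) =
      (1 - (M : ℝ)⁻¹ • Matrix.of (fun _ _ => (1 : ℝ)) : Matrix (Fin M) (Fin M) ℝ) i j := by
  have hi := i.isLt
  have hj := j.isLt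
  have hmod : ((j : ℕ) + M - i) % M = 0 ↔ i = j := by
    rw [Fin.ext_iff]
    rcases le_or_gt (i : ℕ) j with h | h
    · rw [show (j : ℕ) + M - i = (j - i) + M by omega, Nat.add_mod_right,
        Nat.mod_eq_of_lt (by omega)]
      omega
    · rw [Nat.mod_eq_of_lt (by omega)]
      omega
  rw [aVec_sub_aVec_succ hM]
  simp [Matrix.one_apply, hmod]

/-- The entries `a_m` sum to zero, and the circulant matrix `Q`
generated by them satisfies `QÃ = ÃQ = I_M − M⁻¹ 1_M 1_Mᵀ`. -/
theorem stmt17 (M : ℕ) (hM : 2 ≤ M) :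
    (∑ m : Fin M, aVec M (m : ℕ) = 0) ∧
    circQ M * circA0 M = 1 - (M : ℝ)⁻¹ • Matrix.of (fun _ _ => (1 : ℝ)) ∧
    circA0 M * circQ M = 1 - (M : ℝ)⁻¹ • Matrix.of (fun _ _ => (1 : ℝ)) := by
  refine ⟨sum_aVec (by omega), ?_, ?_⟩ <;> ext i j
  · rw [mul_circA0_apply hM, circQ_cyclicSucc, ← aVec_sub_aVec_succ_eq_projection hM]
    rfl
  · rw [circA0_mul_apply hM, circQ_cyclicPred, ← aVec_sub_aVec_succ_eq_projection hM]
    rfl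
end
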